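/- Let n ≥ 4 be an even integer with n ≢ 0 (mod 4), m a positive integer, and C a code of length m over 𝔽₄. Then: (1) Γ_C is integral if and only if C ⊆ C^⊥; (2) Γ_C is unimodular if and only if C = C^⊥; (3) Γ_C is even if and only if 4 divides wt_L(w) for every w ∈ C; (4) Γ_C is even unimodular if and only if C is Type II. -/

import Mathlib

open Finset

/-- The field with four elements. -/
abbrev F4 : Type := GaloisField 2 2

/-- The bilinear form of `m` copies of the dual `D_n` root lattice (`n` even),
written in the dual basis: `B(x,y) = Σ_i Σ_j Σ_s (1/4)(n − 2|j−s|) x_{ij} y_{is}`. -/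
noncomputable def BDev (n m : ℕ) (x y : Fin m → Fin n → ℚ) : ℚ :=
  ∑ i, ∑ j : Fin n, ∑ s : Fin n,
    (1 / 4) * ((n : ℚ) - 2 * |((j : ℕ) : ℚ) - ((s : ℕ) : ℚ)|) * x i j * y i s

/-- `a_i(x)`: the sum of the odd-numbered (`1`-indexed) coordinates, mod 2. -/
def aD (n m : ℕ) (x : Fin m → Fin n → ℤ) (i : Fin m) : ZMod 2 :=
  ((∑ j ∈ Finset.univ.filter (fun j : Fin n => (j : ℕ) % 2 = 0), x i j : ℤ) : ZMod 2)

/-- `b_i(x)`: the sum of the even-numbered (`1`-indexed) coordinates, mod 2. -/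
def bD (n m : ℕ) (x : Fin m → Fin n → ℤ) (i : Fin m) : ZMod 2 :=
  ((∑ j ∈ Finset.univ.filter (fun j : Fin n => (j : ℕ) % 2 = 1), x i j : ℤ) : ZMod 2)

/-- The reduction map `ρ` to `𝔽₄^m`, `ρ(x)_i = a_i ω + b_i ω²`,
relative to a chosen generator `ω` of `𝔽₄`. -/
noncomputable def rhoF4 (ω : F4) (n m : ℕ) (x : Fin m → Fin n → ℤ) :
    Fin m → F4 :=
  fun i => algebraMap (ZMod 2) F4 (aD n m x i) * ω +
    algebraMap (ZMod 2) F4 (bD n m x i) * ω ^ 2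

/-- Coordinatewise conjugation `x̄ = x²` on `𝔽₄^m`. -/
noncomputable def conjF4 (m : ℕ) (w : Fin m → F4) : Fin m → F4 :=
  fun i => (w i) ^ 2

open scoped Classical in
/-- `N₀`: the number of coordinates equal to `0`. -/
noncomputable def N0F (m : ℕ) (w : Fin m → F4) : ℕ :=
  (Finset.univ.filter (fun i => w i = 0)).card

open scoped Classical in
/-- `N₂`: the number of coordinates equal to `1`. -/
noncomputable def N2F (m : ℕ) (w : Fin m → F4) : ℕ :=
  (Finset.univ.filter (fun i => w i = 1)).card

/-- `N₁ = m − N₀ − N₂`. -/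
noncomputable def N1F (m : ℕ) (w : Fin m → F4) : ℕ :=
  m - N0F m w - N2F m w

/-- The Lee weight `wt_L = N₁ + 2N₂`. -/
noncomputable def wtLF (m : ℕ) (w : Fin m → F4) : ℕ :=
  N1F m w + 2 * N2F m w

/-- The Hamming weight `wt_H = N₁ + N₂`. -/
noncomputable def wtHF (m : ℕ) (w : Fin m → F4) : ℕ :=
  N1F m w + N2F m w

/-- The dual code of a set of codewords over `𝔽₄`. -/
def dualCodeF4 (m : ℕ) (C : Set (Fin m → F4)) : Set (Fin m → F4) :=
  {w | ∀ v ∈ C, ∑ i, w i * v i = 0}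

/-- The lattice `Γ_C` constructed from the code `C`. -/
def GammaF4 (ω : F4) (n m : ℕ) (C : Set (Fin m → F4)) :
    Set (Fin m → Fin n → ℤ) :=
  {x | rhoF4 ω n m x ∈ C}

/-- Coercion of an integral vector to a rational vector. -/
def toQD (n m : ℕ) (x : Fin m → Fin n → ℤ) : Fin m → Fin n → ℚ :=
  fun i j => (x i j : ℚ)

/-- The dual lattice `Γ_C^*`, taken inside the `ℚ`-valued vectors. -/
noncomputable def dualLatticeF4 (ω : F4) (n m : ℕ) (C : Set (Fin m → F4)) :
    Set (Fin m → Fin n → ℚ) :=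
  {z | ∀ y ∈ GammaF4 ω n m C, ∃ k : ℤ, (k : ℚ) = BDev n m z (toQD n m y)}

/-- `Γ_C` is integral. -/
def IsIntegralF4 (ω : F4) (n m : ℕ) (C : Set (Fin m → F4)) : Prop :=
  ∀ x ∈ GammaF4 ω n m C, ∀ y ∈ GammaF4 ω n m C,
    ∃ k : ℤ, (k : ℚ) = BDev n m (toQD n m x) (toQD n m y)

/-- `Γ_C` is even. -/
def IsEvenLatF4 (ω : F4) (n m : ℕ) (C : Set (Fin m → F4)) : Prop :=
  IsIntegralF4 ω n m C ∧ ∀ x ∈ GammaF4 ω n m C,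
    ∃ k : ℤ, ((2 * k : ℤ) : ℚ) = BDev n m (toQD n m x) (toQD n m x)

/-- `Γ_C` is unimodular. -/
def IsUnimodularF4 (ω : F4) (n m : ℕ) (C : Set (Fin m → F4)) : Prop :=
  dualLatticeF4 ω n m C = toQD n m '' GammaF4 ω n m C

/-- A code over `𝔽₄` is Hermitian self-dual if `C = C̄^⊥`. -/
def IsHermitianSelfDualF4 (m : ℕ) (C : Set (Fin m → F4)) : Prop :=
  C = dualCodeF4 m (conjF4 m '' C)

def TT (n q : ℕ) (x y : Fin n → ℤ) : ℤ :=
  ∑ j : Fin n, ∑ s : Fin n, ((2 * q + 1 : ℤ) - |((j : ℕ) : ℤ) - ((s : ℕ) : ℤ)|) * x j * y s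

lemma BDev_toQD (n m q : ℕ) (hq : n = 4 * q + 2) (x y : Fin m → Fin n → ℤ) :
    BDev n m (toQD n m x) (toQD n m y) = ((∑ i, TT n q (x i) (y i) : ℤ) : ℚ) / 2 := by
  unfold BDev TT toQD
  push_cast
  simp only [Finset.sum_div]
  refine Finset.sum_congr rfl fun i _ => Finset.sum_congr rfl fun j _ =>
    Finset.sum_congr rfl fun s _ => ?_
  have : (n : ℚ) = 4 * q + 2 := by rw [hq]; push_cast; ring
  rw [this]; ring

lemma int_half (t : ℤ) : (∃ k : ℤ, (k : ℚ) = (t : ℚ) / 2) ↔ (t : ZMod 2) = 0 := by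
  rw [ZMod.intCast_zmod_eq_zero_iff_dvd]
  constructor
  · rintro ⟨k, hk⟩
    refine ⟨k, ?_⟩
    have : (t : ℚ) = ((2 * k : ℤ) : ℚ) := by push_cast; linarith
    exact_mod_cast this
  · rintro ⟨k, hk⟩
    refine ⟨k, ?_⟩
    push_cast [hk]; simp

lemma even_half (t : ℤ) : (∃ k : ℤ, ((2 * k : ℤ) : ℚ) = (t : ℚ) / 2) ↔ (4 : ℤ) ∣ t := by
  constructor
  · rintro ⟨k, hk⟩
    refine ⟨k, ?_⟩
    have : (t : ℚ) = ((4 * k : ℤ) : ℚ) := by push_cast at *; linarith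
    exact_mod_cast this
  · rintro ⟨k, hk⟩
    refine ⟨k, ?_⟩
    push_cast [hk]; ring

/-- Integer sums over the two parity classes. -/
def sA (n : ℕ) (x : Fin n → ℤ) : ℤ := ∑ j : Fin n, if (j : ℕ) % 2 = 0 then x j else 0
def sB (n : ℕ) (x : Fin n → ℤ) : ℤ := ∑ j : Fin n, if (j : ℕ) % 2 = 1 then x j else 0

lemma aD_eq (n m : ℕ) (x : Fin m → Fin n → ℤ) (i : Fin m) : aD n m x i = (sA n (x i) : ZMod 2) := by
  unfold aD sA; rw [Finset.sum_filter]

lemma bD_eq (n m : ℕ) (x : Fin m → Fin n → ℤ) (i : Fin m) : bD n m x i = (sB n (x i) : ZMod 2) := by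
  unfold bD sB; rw [Finset.sum_filter]

/-- same parity indicator -/
def sp (j s : ℕ) : ℤ :=
  (if j % 2 = 0 then 1 else 0) * (if s % 2 = 0 then 1 else 0) +
    (if j % 2 = 1 then 1 else 0) * (if s % 2 = 1 then 1 else 0)

lemma sp_sum (n : ℕ) (x y : Fin n → ℤ) :
    ∑ j : Fin n, ∑ s : Fin n, sp j s * x j * y s = sA n x * sA n y + sB n x * sB n y := by
  unfold sA sB sp
  rw [Finset.sum_mul_sum, Finset.sum_mul_sum, ← Finset.sum_add_distrib]
  refine Finset.sum_congr rfl fun j _ => ?_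
  rw [← Finset.sum_add_distrib]
  refine Finset.sum_congr rfl fun s _ => ?_
  split_ifs <;> ring

lemma sAB_sum (n : ℕ) (x : Fin n → ℤ) : sA n x + sB n x = ∑ j, x j := by
  unfold sA sB
  rw [← Finset.sum_add_distrib]
  refine Finset.sum_congr rfl fun j _ => ?_
  rcases Nat.mod_two_eq_zero_or_one j with h | h <;> simp [h]

lemma coef (j s : ℕ) : ∃ d : ℤ, (1 : ℤ) - |(j : ℤ) - (s : ℤ)| - sp j s = 2 * d := by
  have h : (2 : ℤ) ∣ (1 : ℤ) - |(j : ℤ) - (s : ℤ)| - sp j s := by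
    unfold sp
    rcases abs_cases ((j : ℤ) - (s : ℤ)) with h | h <;> rw [h.1] <;> split_ifs <;> omega
  exact h

/-- half of the deviation of the coefficient -/
def dd (j s : ℕ) : ℤ := ((1 : ℤ) - |(j : ℤ) - (s : ℤ)| - sp j s) / 2

lemma dd_spec (j s : ℕ) : (1 : ℤ) - |(j : ℤ) - (s : ℤ)| = sp j s + 2 * dd j s := by
  obtain ⟨d, hd⟩ := coef j s
  unfold dd
  rw [hd]; simp; linarith

lemma dd_symm (j s : ℕ) : dd j s = dd s j := by
  unfold dd sp
  rw [abs_sub_comm]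
  congr 2; ring

lemma dd_self (j : ℕ) : dd j j = 0 := by
  unfold dd sp
  rcases Nat.mod_two_eq_zero_or_one j with h | h <;> simp [h]

lemma TT_eq (n q : ℕ) (x y : Fin n → ℤ) :
    TT n q x y = 2 * q * ((sA n x + sB n x) * (sA n y + sB n y)) +
      (sA n x * sA n y + sB n x * sB n y) + 2 * ∑ j : Fin n, ∑ s : Fin n, dd j s * x j * y s := by
  rw [← sp_sum, sAB_sum, sAB_sum, Finset.sum_mul_sum]
  unfold TT
  simp only [Finset.mul_sum]
  simp only [← Finset.sum_add_distrib]
  refine Finset.sum_congr rfl fun j _ => Finset.sum_congr rfl fun s _ => ?_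
  have := dd_spec j s
  linear_combination (x j * y s) * this

lemma dd_even (n : ℕ) (x : Fin n → ℤ) : (2 : ℤ) ∣ ∑ j : Fin n, ∑ s : Fin n, dd j s * x j * x s := by
  have h2 : (2 : ZMod 2) = 0 := rfl
  have := (ZMod.intCast_zmod_eq_zero_iff_dvd (∑ j : Fin n, ∑ s : Fin n, dd j s * x j * x s) 2).1
  apply this
  push_cast
  rw [← Finset.sum_product']
  refine Finset.sum_involution (fun p _ => p.swap) ?_ ?_ ?_ ?_
  · rintro ⟨j, s⟩ _
    simp only [Prod.swap]
    rw [dd_symm s j]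
    linear_combination ((dd j s : ZMod 2) * (x j : ZMod 2) * (x s : ZMod 2)) * h2
  · rintro ⟨j, s⟩ _ hne heq
    simp only [Prod.swap, Prod.mk.injEq] at heq
    apply hne
    rw [heq.1]; simp [dd_self]
  · simp
  · simp

lemma TT_mod2 (n q : ℕ) (x y : Fin n → ℤ) :
    ((TT n q x y : ℤ) : ZMod 2) = (sA n x : ZMod 2) * sA n y + (sB n x : ZMod 2) * sB n y := by
  have h2 : (2 : ZMod 2) = 0 := rfl
  rw [TT_eq]; push_cast; rw [h2]; ring

lemma T_mod2 (n m q : ℕ) (x y : Fin m → Fin n → ℤ) :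
    ((∑ i, TT n q (x i) (y i) : ℤ) : ZMod 2) =
      ∑ i, (aD n m x i * aD n m y i + bD n m x i * bD n m y i) := by
  push_cast
  refine Finset.sum_congr rfl fun i _ => ?_
  rw [TT_mod2]; simp only [aD_eq, bD_eq]

/-- F4 coordinates -/
noncomputable def ph (ω : F4) (p : ZMod 2 × ZMod 2) : F4 :=
  algebraMap (ZMod 2) F4 p.1 * ω + algebraMap (ZMod 2) F4 p.2 * ω ^ 2

lemma two_F4 : (2 : F4) = 0 := by
  have : ((2 : ℕ) : F4) = 0 := CharP.cast_eq_zero F4 2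
  exact_mod_cast this

lemma ph_zero_iff (ω : F4) (hω : ω ^ 2 = ω + 1) (p : ZMod 2 × ZMod 2) : ph ω p = 0 ↔ p = 0 := by
  constructor
  · obtain ⟨a, b⟩ := p
    intro h
    have h0 : ω ≠ 0 := by rintro rfl; simp at hω
    have h1 : ω + 1 ≠ 0 := by rw [← hω]; exact pow_ne_zero _ h0
    unfold ph at h
    have hz : ∀ c : ZMod 2, c = 0 ∨ c = 1 := by decide
    rcases hz a with rfl | rfl <;> rcases hz b with rfl | rfl
    · rfl
    · simp [h0] at h
    · simp [h0] at h
    · exfalso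
      simp only [map_one, one_mul] at h
      have : (1 : F4) = 0 := by linear_combination h - hω - ω * two_F4
      exact one_ne_zero this
  · rintro rfl; simp [ph]

lemma ph_add (ω : F4) (p r : ZMod 2 × ZMod 2) : ph ω (p + r) = ph ω p + ph ω r := by
  simp [ph]; ring

lemma ph_sub (ω : F4) (p r : ZMod 2 × ZMod 2) : ph ω (p - r) = ph ω p - ph ω r := by
  simp [ph]; ring

lemma ph_sum {ι : Type*} (ω : F4) (s : Finset ι) (f : ι → ZMod 2 × ZMod 2) :
    ph ω (∑ i ∈ s, f i) = ∑ i ∈ s, ph ω (f i) := by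
  classical
  induction s using Finset.induction_on with
  | empty => simp [ph]
  | insert a s ha ih => rw [Finset.sum_insert ha, Finset.sum_insert ha, ph_add, ih]

lemma ph_bij (ω : F4) (hω : ω ^ 2 = ω + 1) : Function.Bijective (ph ω) := by
  haveI : Fintype F4 := Fintype.ofFinite _
  rw [Fintype.bijective_iff_injective_and_card]
  constructor
  · intro p r h
    have : ph ω (p - r) = 0 := by rw [ph_sub, h, sub_self]
    exact sub_eq_zero.1 ((ph_zero_iff ω hω _).1 this)
  · rw [← Nat.card_eq_fintype_card (α := F4), GaloisField.card 2 2 (by norm_num)]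
    simp [ZMod.card]

lemma ph_mul (ω : F4) (hω : ω ^ 2 = ω + 1) (a b c d : ZMod 2) :
    ph ω (a, b) * ph ω (c, d) = ph ω (b * d + a * d + b * c, a * c + a * d + b * c) := by
  simp only [ph, map_add, map_mul]
  set A := algebraMap (ZMod 2) F4 a
  set B := algebraMap (ZMod 2) F4 b
  set U := algebraMap (ZMod 2) F4 c
  set V := algebraMap (ZMod 2) F4 d
  have h3 : ω ^ 3 = 1 := by linear_combination (ω + 1) * hω + ω * two_F4
  have h4 : ω ^ 4 = ω := by linear_combination ω * h3
  have h1 : ω + ω ^ 2 = 1 := by linear_combination hω + ω * two_F4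
  linear_combination (A * V + B * U) * h3 + B * V * h4 - (A * V + B * U) * h1

lemma ph_one (ω : F4) (hω : ω ^ 2 = ω + 1) : ph ω (1, 1) = 1 := by
  simp only [ph, map_one]
  linear_combination hω + ω * two_F4

lemma rho_eq (ω : F4) (n m : ℕ) (x : Fin m → Fin n → ℤ) (i : Fin m) :
    rhoF4 ω n m x i = ph ω (aD n m x i, bD n m x i) := rfl

lemma rho_surj (ω : F4) (hω : ω ^ 2 = ω + 1) (n m : ℕ) (hn : 4 ≤ n) (w : Fin m → F4) :
    ∃ x, rhoF4 ω n m x = w := by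
  choose p hp using fun i => (ph_bij ω hω).2 (w i)
  refine ⟨fun i j => if j = ⟨0, by omega⟩ then ((p i).1.val : ℤ) else
    if j = ⟨1, by omega⟩ then ((p i).2.val : ℤ) else 0, ?_⟩
  funext i
  rw [rho_eq, ← hp i]
  congr 1
  refine Prod.ext ?_ ?_
  · simp only [aD]
    rw [Finset.sum_eq_single ⟨0, by omega⟩]
    · simp
    · intro j hj hj0
      rw [if_neg hj0, if_neg]
      rintro rfl
      simp at hj
    · simp
  · simp only [bD]
    rw [Finset.sum_eq_single ⟨1, by omega⟩]
    · simp
    · intro j hj hj0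
      rw [if_neg, if_neg hj0]
      rintro rfl
      simp at hj
    · simp

lemma dot_eq (ω : F4) (hω : ω ^ 2 = ω + 1) (n m : ℕ) (x y : Fin m → Fin n → ℤ) :
    ∑ i, rhoF4 ω n m x i * rhoF4 ω n m y i =
      ph ω (∑ i, (bD n m x i * bD n m y i + aD n m x i * bD n m y i + bD n m x i * aD n m y i),
        ∑ i, (aD n m x i * aD n m y i + aD n m x i * bD n m y i + bD n m x i * aD n m y i)) := by
  simp only [rho_eq, ph_mul ω hω]
  rw [← ph_sum]
  congr 1
  refine Prod.ext ?_ ?_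
  · simp [Prod.fst_sum]
  · simp [Prod.snd_sum]

lemma dual_iff (ω : F4) (hω : ω ^ 2 = ω + 1) (n m q : ℕ) (hn : 4 ≤ n) (hq : n = 4 * q + 2)
    (C : Submodule F4 (Fin m → F4)) (x : Fin m → Fin n → ℤ) :
    (∀ y ∈ GammaF4 ω n m (C : Set _), ∃ k : ℤ, (k : ℚ) = BDev n m (toQD n m x) (toQD n m y)) ↔
      rhoF4 ω n m x ∈ dualCodeF4 m (C : Set _) := by
  have h2 : (2 : ZMod 2) = 0 := rfl
  simp only [BDev_toQD n m q hq, int_half, T_mod2]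
  constructor
  · intro h v hv
    obtain ⟨y, rfl⟩ := rho_surj ω hω n m hn v
    have hv2 : ω • rhoF4 ω n m y ∈ C := C.smul_mem ω hv
    obtain ⟨y', hy'⟩ := rho_surj ω hω n m hn (ω • rhoF4 ω n m y)
    have e1 := h y hv
    have e2 := h y' (by show rhoF4 ω n m y' ∈ (C : Set _); rw [hy']; exact hv2)
    have hc : ∀ i, aD n m y' i = bD n m y i ∧ bD n m y' i = aD n m y i + bD n m y i := by
      intro i
      have := congrFun hy' i
      rw [Pi.smul_apply, smul_eq_mul, rho_eq, rho_eq] at this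
      have hw : ω = ph ω (1, 0) := by simp [ph]
      nth_rewrite 2 [hw] at this
      rw [ph_mul ω hω] at this
      have := (ph_bij ω hω).1 this
      rw [Prod.mk.injEq] at this
      simpa using this
    simp only [fun i => (hc i).1, fun i => (hc i).2] at e2
    rw [dot_eq ω hω, ph_zero_iff ω hω]
    refine Prod.ext ?_ ?_
    · simp only [Prod.fst_zero]
      rw [← e2]
      exact Finset.sum_congr rfl fun i _ => by ring
    · simp only [Prod.snd_zero]
      have : (0 : ZMod 2) = 0 + 0 := by simp
      rw [this]
      nth_rewrite 1 [← e1]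
      rw [← e2, ← Finset.sum_add_distrib]
      refine Finset.sum_congr rfl fun i _ => ?_
      linear_combination (- bD n m x i * bD n m y i) * h2
  · intro h y hy
    have := h _ hy
    rw [dot_eq ω hω, ph_zero_iff ω hω, Prod.ext_iff] at this
    obtain ⟨e1, e2⟩ := this
    simp only [Prod.fst_zero, Prod.snd_zero] at e1 e2
    have e3 : (0 : ZMod 2) = 0 + 0 := by simp
    rw [e3]
    nth_rewrite 1 [← e1]
    rw [← e2, ← Finset.sum_add_distrib]
    refine Finset.sum_congr rfl fun i _ => ?_
    linear_combination (- aD n m x i * bD n m y i - bD n m x i * aD n m y i) * h2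

/-- kernel -/
def KK (n : ℕ) (j s : ℕ) : ℚ := (1 / 4) * ((n : ℚ) - 2 * |(j : ℚ) - (s : ℚ)|)

lemma dual_vec (ω : F4) (n m : ℕ) (C : Submodule F4 (Fin m → F4)) (z : Fin m → Fin n → ℚ)
    (i : Fin m) (k p r : Fin n) (σ : ℤ) (hσ : σ = 1 ∨ σ = -1) (hpr : (p : ℕ) % 2 = (r : ℕ) % 2)
    (hK : ∀ j : Fin n, 2 * KK n j k - KK n j p + σ * KK n j r = if j = k then 1 else 0)
    (hz : z ∈ dualLatticeF4 ω n m (C : Set _)) : ∃ t : ℤ, (t : ℚ) = z i k := by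
  have h2 : (2 : ZMod 2) = 0 := rfl
  set y : Fin n → ℤ := (2 : ℤ) • Pi.single k 1 - Pi.single p 1 + σ • Pi.single r 1 with hy
  set Y : Fin m → Fin n → ℤ := Pi.single i y with hY
  have hσ2 : ((σ : ℤ) : ZMod 2) = 1 := by rcases hσ with rfl | rfl <;> decide
  have hYm : Y ∈ GammaF4 ω n m (C : Set _) := by
    have : rhoF4 ω n m Y = 0 := by
      funext i'
      rw [rho_eq]
      by_cases hi : i' = i
      · subst hi
        have ha : aD n m Y i' = 0 := by
          simp only [aD, hY, hy, Pi.single_eq_same, Pi.add_apply, Pi.sub_apply, Pi.smul_apply,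
            Finset.sum_add_distrib, Finset.sum_sub_distrib, ← Finset.smul_sum, Pi.single_apply,
            Finset.sum_filter]
          simp only [← ite_and]
          rw [Finset.sum_eq_single k (by intro b _ hb; simp [hb]) (by simp),
            Finset.sum_eq_single p (by intro b _ hb; simp [hb]) (by simp),
            Finset.sum_eq_single r (by intro b _ hb; simp [hb]) (by simp)]
          simp only [and_true, hpr, smul_eq_mul]
          push_cast
          rw [hσ2, h2]; ring
        have hb : bD n m Y i' = 0 := by
          simp only [bD, hY, hy, Pi.single_eq_same, Pi.add_apply, Pi.sub_apply, Pi.smul_apply,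
            Finset.sum_add_distrib, Finset.sum_sub_distrib, ← Finset.smul_sum, Pi.single_apply,
            Finset.sum_filter]
          simp only [← ite_and]
          rw [Finset.sum_eq_single k (by intro b _ hb; simp [hb]) (by simp),
            Finset.sum_eq_single p (by intro b _ hb; simp [hb]) (by simp),
            Finset.sum_eq_single r (by intro b _ hb; simp [hb]) (by simp)]
          simp only [and_true, hpr, smul_eq_mul]
          push_cast
          rw [hσ2, h2]; ring
        rw [ha, hb]; simp [ph]
      · simp [aD, bD, hY, hi, ph]
    show rhoF4 ω n m Y ∈ C
    rw [this]; exact C.zero_mem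
  obtain ⟨t, ht⟩ := hz Y hYm
  refine ⟨t, ?_⟩
  rw [ht]
  unfold BDev
  rw [Finset.sum_eq_single i]
  · have : ∀ j : Fin n, ∑ s : Fin n, (1 / 4) * ((n : ℚ) - 2 * |((j : ℕ) : ℚ) - ((s : ℕ) : ℚ)|) *
        z i j * toQD n m Y i s = if j = k then z i j else 0 := by
      intro j
      have e : ∀ s : Fin n, (1 / 4) * ((n : ℚ) - 2 * |((j : ℕ) : ℚ) - ((s : ℕ) : ℚ)|) *
        z i j * toQD n m Y i s = (if s = k then 2 * KK n j s * z i j else 0)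
          - (if s = p then KK n j s * z i j else 0) + (if s = r then σ * KK n j s * z i j else 0) := by
        intro s
        simp only [toQD, hY, hy, Pi.single_eq_same, Pi.add_apply, Pi.sub_apply, Pi.smul_apply,
          Pi.single_apply, KK, smul_eq_mul]
        push_cast
        split_ifs <;> ring
      simp only [e, Finset.sum_add_distrib, Finset.sum_sub_distrib, Finset.sum_ite_eq',
        Finset.mem_univ, if_true]
      have := hK j
      split_ifs at this ⊢ with hjk
      · linear_combination (z i j) * this
      · linear_combination (z i j) * this
    simp only [this]
    simp
  · intro i' _ hi'
    simp [toQD, hY, hi']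
  · simp

lemma KK_interior (n k j : ℕ) :
    2 * KK n j (k + 1) - KK n j k + ((-1 : ℤ) : ℚ) * KK n j (k + 2) = if j = k + 1 then 1 else 0 := by
  unfold KK
  push_cast
  rcases lt_trichotomy j (k + 1) with h | h | h
  · have h' : (j : ℚ) ≤ k := by exact_mod_cast (by omega : j ≤ k)
    rw [if_neg (by omega), abs_of_nonpos (by linarith), abs_of_nonpos (by linarith),
      abs_of_nonpos (by linarith)]; ring
  · subst h
    rw [if_pos rfl]; push_cast
    rw [abs_of_nonneg (by linarith), abs_of_nonneg (by linarith), abs_of_nonpos (by linarith)]; ring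
  · have h' : (k : ℚ) + 2 ≤ j := by exact_mod_cast (by omega : k + 2 ≤ j)
    rw [if_neg (by omega), abs_of_nonneg (by linarith), abs_of_nonneg (by linarith),
      abs_of_nonneg (by linarith)]; ring

lemma KK_left (n j : ℕ) (hj : j ≤ n + 1) :
    2 * KK (n + 2) j 0 - KK (n + 2) j 1 + ((1 : ℤ) : ℚ) * KK (n + 2) j (n + 1) = if j = 0 then 1 else 0 := by
  unfold KK
  have h1 : (j : ℚ) ≤ n + 1 := by exact_mod_cast hj
  have h0 : (0 : ℚ) ≤ j := by positivity
  push_cast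
  rw [abs_of_nonneg (by linarith : (0 : ℚ) ≤ j - 0), abs_of_nonpos (by linarith : (j : ℚ) - (n + 1) ≤ 0)]
  rcases Nat.eq_zero_or_pos j with h | h
  · subst h; norm_num; ring
  · have h' : (1 : ℚ) ≤ j := by exact_mod_cast h
    rw [if_neg (by omega), abs_of_nonneg (by linarith)]; ring

lemma KK_right (n j : ℕ) (hj : j ≤ n + 1) :
    2 * KK (n + 2) j (n + 1) - KK (n + 2) j n + ((1 : ℤ) : ℚ) * KK (n + 2) j 0 = if j = n + 1 then 1 else 0 := by
  unfold KK
  have h1 : (j : ℚ) ≤ n + 1 := by exact_mod_cast hj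
  have h0 : (0 : ℚ) ≤ j := by positivity
  push_cast
  rw [abs_of_nonneg (by linarith : (0 : ℚ) ≤ j - 0), abs_of_nonpos (by linarith : (j : ℚ) - (n + 1) ≤ 0)]
  rcases eq_or_lt_of_le hj with h | h
  · subst h; push_cast; rw [abs_of_nonneg (by linarith)]; simp; ring
  · have h' : (j : ℚ) ≤ n := by exact_mod_cast (by omega : j ≤ n)
    rw [if_neg (by omega), abs_of_nonpos (by linarith)]; ring

lemma dual_int (ω : F4) (n m q : ℕ) (hn : 4 ≤ n) (hq : n = 4 * q + 2)
    (C : Submodule F4 (Fin m → F4)) (z : Fin m → Fin n → ℚ)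
    (hz : z ∈ dualLatticeF4 ω n m (C : Set _)) : ∃ x, toQD n m x = z := by
  have : ∀ i k, ∃ t : ℤ, (t : ℚ) = z i k := by
    intro i ⟨k, hk⟩
    rcases Nat.eq_zero_or_pos k with h0 | h0
    · subst h0
      refine dual_vec ω n m C z i ⟨0, hk⟩ ⟨1, by omega⟩ ⟨n - 1, by omega⟩ 1 (Or.inl rfl)
        (by simp only; omega) ?_ hz
      intro j
      obtain ⟨l, rfl⟩ : ∃ l, n = l + 2 := ⟨n - 2, by omega⟩
      have := KK_left l j (by omega)
      simp only [Fin.ext_iff]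
      exact this
    · rcases eq_or_ne k (n - 1) with h1 | h1
      · refine dual_vec ω n m C z i ⟨k, hk⟩ ⟨n - 2, by omega⟩ ⟨0, by omega⟩ 1 (Or.inl rfl)
          (by simp only; omega) ?_ hz
        intro j
        obtain ⟨l, rfl⟩ : ∃ l, n = l + 2 := ⟨n - 2, by omega⟩
        have hk' : k = l + 1 := by omega
        subst hk'
        have := KK_right l j (by omega)
        simp only [Fin.ext_iff]
        exact this
      · refine dual_vec ω n m C z i ⟨k, hk⟩ ⟨k - 1, by omega⟩ ⟨k + 1, by omega⟩ (-1) (Or.inr rfl)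
          (by simp only; omega) ?_ hz
        intro j
        obtain ⟨l, rfl⟩ : ∃ l, k = l + 1 := ⟨k - 1, by omega⟩
        have := KK_interior n l j
        simp only [Fin.ext_iff]
        exact this
  choose x hx using this
  exact ⟨x, by funext i k; exact hx i k⟩

open scoped Classical in
lemma wtLF_eq (m : ℕ) (w : Fin m → F4) :
    wtLF m w = ∑ i, if w i = 0 then 0 else if w i = 1 then 2 else 1 := by
  have key : N0F m w + N2F m w + ∑ i, (if w i = 0 then 0 else if w i = 1 then 0 else 1) = m := by
    unfold N0F N2F
    rw [Finset.card_filter, Finset.card_filter, ← Finset.sum_add_distrib, ← Finset.sum_add_distrib]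
    trans ∑ i : Fin m, 1
    · refine Finset.sum_congr rfl fun i _ => ?_
      by_cases h0 : w i = 0
      · simp [h0]
      · by_cases h1 : w i = 1 <;> simp [h0, h1]
    · simp
  have k2 : ∑ i, (if w i = 0 then 0 else if w i = 1 then 2 else 1) =
      2 * N2F m w + ∑ i, (if w i = 0 then 0 else if w i = 1 then 0 else 1) := by
    unfold N2F
    rw [Finset.card_filter, Finset.mul_sum, ← Finset.sum_add_distrib]
    refine Finset.sum_congr rfl fun i _ => ?_
    by_cases h0 : w i = 0
    · simp [h0]
    · by_cases h1 : w i = 1 <;> simp [h0, h1]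
  rw [k2]
  unfold wtLF N1F
  omega

open scoped Classical in
lemma TT_lee (ω : F4) (hω : ω ^ 2 = ω + 1) (n m q : ℕ) (x : Fin m → Fin n → ℤ) (i : Fin m) :
    (4 : ℤ) ∣ TT n q (x i) (x i) - (2 * q + 1) * ((if rhoF4 ω n m x i = 0 then 0 else
      if rhoF4 ω n m x i = 1 then 2 else 1 : ℕ) : ℤ) := by
  have e0 : rhoF4 ω n m x i = 0 ↔ (sA n (x i) % 2 = 0 ∧ sB n (x i) % 2 = 0) := by
    rw [rho_eq, ph_zero_iff ω hω, Prod.ext_iff, aD_eq, bD_eq]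
    simp only [Prod.fst_zero, Prod.snd_zero, ZMod.intCast_zmod_eq_zero_iff_dvd]
    simp only [Nat.cast_ofNat]; omega
  have e1 : rhoF4 ω n m x i = 1 ↔ (sA n (x i) % 2 = 1 ∧ sB n (x i) % 2 = 1) := by
    have h1 : ∀ t : ℤ, ((t : ZMod 2) = 1) ↔ t % 2 = 1 := by
      intro t
      have := ZMod.intCast_eq_intCast_iff t 1 2
      rw [Int.cast_one] at this
      rw [this]; simp [Int.ModEq]
    rw [← ph_one ω hω, rho_eq, (ph_bij ω hω).1.eq_iff, Prod.mk.injEq, aD_eq, bD_eq, h1, h1]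
  obtain ⟨D, hD⟩ := dd_even n (x i)
  rw [TT_eq, hD]
  simp only [e0, e1]
  generalize sA n (x i) = A
  generalize sB n (x i) = B
  rcases Int.even_or_odd' A with ⟨a, rfl | rfl⟩ <;> rcases Int.even_or_odd' B with ⟨b, rfl | rfl⟩
  · rw [if_pos (by omega)]
    exact ⟨2 * q * (a + b) ^ 2 + a ^ 2 + b ^ 2 + D, by push_cast; ring⟩
  · rw [if_neg (by omega), if_neg (by omega)]
    exact ⟨2 * q * ((a + b) ^ 2 + (a + b)) + a ^ 2 + b ^ 2 + b + D, by push_cast; ring⟩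
  · rw [if_neg (by omega), if_neg (by omega)]
    exact ⟨2 * q * ((a + b) ^ 2 + (a + b)) + a ^ 2 + a + b ^ 2 + D, by push_cast; ring⟩
  · rw [if_neg (by omega), if_pos (by omega)]
    exact ⟨2 * q * (a + b + 1) ^ 2 + a ^ 2 + a + b ^ 2 + b - q + D, by push_cast; ring⟩

lemma norm_iff (ω : F4) (hω : ω ^ 2 = ω + 1) (n m q : ℕ) (hq : n = 4 * q + 2)
    (x : Fin m → Fin n → ℤ) :
    (∃ k : ℤ, ((2 * k : ℤ) : ℚ) = BDev n m (toQD n m x) (toQD n m x)) ↔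
      4 ∣ wtLF m (rhoF4 ω n m x) := by
  classical
  rw [BDev_toQD n m q hq, even_half, wtLF_eq]
  have h : (4 : ℤ) ∣ ∑ i, TT n q (x i) (x i) - (2 * q + 1) *
      ((∑ i, if rhoF4 ω n m x i = 0 then 0 else if rhoF4 ω n m x i = 1 then 2 else 1 : ℕ) : ℤ) := by
    rw [Nat.cast_sum, Finset.mul_sum, ← Finset.sum_sub_distrib]
    exact Finset.dvd_sum fun i _ => TT_lee ω hω n m q x i
  rw [(dvd_iff_dvd_of_dvd_sub h)]
  have hc : IsCoprime (4 : ℤ) (2 * q + 1) := ⟨-(q ^ 2 + q : ℤ), 2 * q + 1, by ring⟩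
  have hd := fun N : ℤ => (⟨hc.dvd_of_dvd_mul_left, fun h => Dvd.dvd.mul_left h _⟩ :
    (4 : ℤ) ∣ (2 * q + 1) * N ↔ 4 ∣ N)
  rw [hd]
  exact_mod_cast Iff.rfl

lemma rho_add (ω : F4) (n m : ℕ) (x y : Fin m → Fin n → ℤ) :
    rhoF4 ω n m (x + y) = rhoF4 ω n m x + rhoF4 ω n m y := by
  funext i
  rw [Pi.add_apply, rho_eq, rho_eq, rho_eq, ← ph_add]
  congr 1
  simp [aD, bD, Finset.sum_add_distrib]

lemma BDev_polar (n m : ℕ) (x y : Fin m → Fin n → ℤ) :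
    BDev n m (toQD n m (x + y)) (toQD n m (x + y)) =
      BDev n m (toQD n m x) (toQD n m x) + BDev n m (toQD n m y) (toQD n m y) +
        2 * BDev n m (toQD n m x) (toQD n m y) := by
  have hs : BDev n m (toQD n m x) (toQD n m y) = BDev n m (toQD n m y) (toQD n m x) := by
    unfold BDev
    refine Finset.sum_congr rfl fun i _ => ?_
    rw [Finset.sum_comm]
    refine Finset.sum_congr rfl fun j _ => Finset.sum_congr rfl fun s _ => ?_
    rw [abs_sub_comm]; ring
  rw [two_mul]
  nth_rewrite 2 [hs]
  unfold BDev
  simp only [← Finset.sum_add_distrib]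
  refine Finset.sum_congr rfl fun i _ => Finset.sum_congr rfl fun j _ =>
    Finset.sum_congr rfl fun s _ => ?_
  simp only [toQD, Pi.add_apply]
  push_cast; ring

theorem stmt15 (n m : ℕ) (hn : 4 ≤ n) (heven : Even n) (hn4 : ¬ (4 ∣ n))
    (hm : 0 < m) (ω : F4) (hω : ω ^ 2 = ω + 1)
    (C : Submodule F4 (Fin m → F4)) :
    (IsIntegralF4 ω n m (C : Set _) ↔
        (C : Set _) ⊆ dualCodeF4 m (C : Set _)) ∧
    (IsUnimodularF4 ω n m (C : Set _) ↔
        (C : Set _) = dualCodeF4 m (C : Set _)) ∧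
    (IsEvenLatF4 ω n m (C : Set _) ↔ ∀ w ∈ C, 4 ∣ wtLF m w) ∧
    ((IsEvenLatF4 ω n m (C : Set _) ∧ IsUnimodularF4 ω n m (C : Set _)) ↔
        ((C : Set _) = dualCodeF4 m (C : Set _) ∧
          ∀ w ∈ C, 4 ∣ wtLF m w)) := by
  obtain ⟨q, hq⟩ : ∃ q, n = 4 * q + 2 := ⟨n / 4, by obtain ⟨r, hr⟩ := heven; omega⟩
  have P1 : IsIntegralF4 ω n m (C : Set _) ↔ (C : Set _) ⊆ dualCodeF4 m (C : Set _) := by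
    constructor
    · intro h w hw
      obtain ⟨x, rfl⟩ := rho_surj ω hω n m hn w
      exact (dual_iff ω hω n m q hn hq C x).1 (h x hw)
    · intro h x hx
      exact (dual_iff ω hω n m q hn hq C x).2 (h hx)
  have P2 : IsUnimodularF4 ω n m (C : Set _) ↔ (C : Set _) = dualCodeF4 m (C : Set _) := by
    have hinj : Function.Injective (toQD n m) := by
      intro x y h
      funext i j
      have := congrFun (congrFun h i) j
      simpa [toQD] using this
    have hdl : ∀ x, toQD n m x ∈ dualLatticeF4 ω n m (C : Set _) ↔
        rhoF4 ω n m x ∈ dualCodeF4 m (C : Set _) := dual_iff ω hω n m q hn hq C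
    constructor
    · intro h
      ext w
      obtain ⟨x, rfl⟩ := rho_surj ω hω n m hn w
      rw [← hdl, h, hinj.mem_set_image]
      exact Iff.rfl
    · intro h
      ext z
      constructor
      · intro hz
        obtain ⟨x, rfl⟩ := dual_int ω n m q hn hq C z hz
        refine ⟨x, ?_, rfl⟩
        show rhoF4 ω n m x ∈ (C : Set _)
        rw [h]
        exact (hdl x).1 hz
      · rintro ⟨x, hx, rfl⟩
        rw [hdl, ← h]
        exact hx
  have P3 : IsEvenLatF4 ω n m (C : Set _) ↔ ∀ w ∈ C, 4 ∣ wtLF m w := by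
    constructor
    · rintro ⟨_, h⟩ w hw
      obtain ⟨x, rfl⟩ := rho_surj ω hω n m hn w
      exact (norm_iff ω hω n m q hq x).1 (h x hw)
    · intro h
      have h' : ∀ x ∈ GammaF4 ω n m (C : Set _),
          ∃ k : ℤ, ((2 * k : ℤ) : ℚ) = BDev n m (toQD n m x) (toQD n m x) :=
        fun x hx => (norm_iff ω hω n m q hq x).2 (h _ hx)
      refine ⟨fun x hx y hy => ?_, h'⟩
      obtain ⟨k1, e1⟩ := h' x hx
      obtain ⟨k2, e2⟩ := h' y hy
      obtain ⟨k3, e3⟩ := h' (x + y) (by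
        show rhoF4 ω n m (x + y) ∈ C
        rw [rho_add]; exact C.add_mem hx hy)
      rw [BDev_polar] at e3
      refine ⟨k3 - k1 - k2, ?_⟩
      push_cast at *
      linarith
  refine ⟨P1, P2, P3, ?_⟩
  rw [P2, P3, and_comm]
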